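/- Let p ≥ 1 and let α, β be complex numbers with Re(α) > p-1 and Re(β) > p-1. Then ∫_{0 < X < I} det(X)^{α-p} det(I - X)^{β-p} dμ_p(X) = Γ̃_p(α) Γ̃_p(β) / Γ̃_p(α+β), where the integral is over the set of self-adjoint p×p complex matrices X such that both X and I - X are positive definite, and the complex powers are of the positive real numbers det(X), det(I-X). -/

import Mathlib

open MeasureTheory Matrix
open scoped ComplexOrder

noncomputable section

/-- Parameter space `ℝ^p × ℂ^{p(p-1)/2}` for `p × p` Hermitian matrices:
the real diagonal entries together with the strictly upper-triangular complex entries. -/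
abbrev HermParam (p : ℕ) : Type :=
  (Fin p → ℝ) × ({ q : Fin p × Fin p // q.1 < q.2 } → ℂ)

/-- The linear isomorphism sending the parameters to the corresponding self-adjoint matrix. -/
def toHermMatrix (p : ℕ) (T : HermParam p) : Matrix (Fin p) (Fin p) ℂ :=
  Matrix.of fun i j =>
    if h : i < j then T.2 ⟨(i, j), h⟩
    else if h' : j < i then (starRingEnd ℂ) (T.2 ⟨(j, i), h'⟩)
    else (T.1 i : ℂ)

noncomputable instance matrixComplexMeasureSpace (m n : ℕ) :
    MeasureSpace (Matrix (Fin m) (Fin n) ℂ) :=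
  inferInstanceAs (MeasureSpace (Fin m → Fin n → ℂ))

/-- The Lebesgue measure `μ_p` on Herm(p), realized as a measure on the space of
`p × p` complex matrices: the pushforward of Lebesgue measure on the parameter space
under the linear isomorphism `toHermMatrix p`. -/
def hermLebesgue (p : ℕ) : Measure (Matrix (Fin p) (Fin p) ℂ) :=
  Measure.map (toHermMatrix p) volume

/-- The complex matrix-variate gamma function
`Γ̃_p(α) = π^{p(p-1)/2} ∏_{j=1}^p Γ(α - j + 1) = π^{p(p-1)/2} ∏_{j=0}^{p-1} Γ(α - j)`. -/
def cGammaP (p : ℕ) (α : ℂ) : ℂ :=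
  (Real.pi : ℂ) ^ (p * (p - 1) / 2) * ∏ j : Fin p, Complex.Gamma (α - j)

end


/-- The truncated power `u ↦ u₊ ^ c`, vanishing for `u ≤ 0`. -/
noncomputable def posPow (c : ℂ) (u : ℝ) : ℂ := if 0 < u then (u : ℂ) ^ c else 0

theorem measurable_posPow (c : ℂ) : Measurable (posPow c) :=
  Measurable.ite measurableSet_Ioi (by fun_prop) measurable_const

theorem norm_posPow (c : ℂ) (u : ℝ) : ((‖posPow c u‖ : ℝ) : ℂ) = posPow c.re u := by
  unfold posPow
  split_ifs with h
  · rw [Complex.norm_cpow_eq_rpow_re_of_pos h, Complex.ofReal_cpow h.le]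
  · simp

/-- A function on a product is integrable as soon as its slices are and the integrals of the norms
of the slices form an integrable function, in which case the integral is an iterated integral. -/
theorem integrable_and_integral_prod {X Y : Type*} [MeasurableSpace X] [MeasurableSpace Y]
    {μ : Measure X} {ν : Measure Y} [SFinite μ] [SFinite ν] {f : X × Y → ℂ} (hf : Measurable f)
    {g G : X → ℂ} (hs : ∀ x, Integrable (fun y => f (x, y)) ν)
    (hg : ∀ x, ∫ y, f (x, y) ∂ν = g x)
    (hG : ∀ x, ∫ y, ((‖f (x, y)‖ : ℝ) : ℂ) ∂ν = G x) (hGi : Integrable G μ) :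
    Integrable f (μ.prod ν) ∧ ∫ z, f z ∂(μ.prod ν) = ∫ x, g x ∂μ := by
  have hi : Integrable f (μ.prod ν) := by
    rw [integrable_prod_iff hf.aestronglyMeasurable]
    refine ⟨.of_forall hs, ?_⟩
    have : (fun x => ∫ y, ‖f (x, y)‖ ∂ν) = fun x => (G x).re := by
      funext x
      rw [← hG x, integral_complex_ofReal, Complex.ofReal_re]
    rw [this]
    exact hGi.re
  refine ⟨hi, ?_⟩
  rw [integral_prod _ hi]
  simp only [hg]

theorem integral_posPow_mul_posPow {c d : ℂ} (hc : -1 < c.re) (hd : -1 < d.re) (s e : ℝ) :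
    Integrable (fun x : ℝ => posPow c (x - s) * posPow d (e - x)) ∧
    ∫ x : ℝ, posPow c (x - s) * posPow d (e - x) =
      Complex.Gamma (c + 1) * Complex.Gamma (d + 1) / Complex.Gamma (c + d + 2) *
        posPow (c + d + 1) (e - s) := by
  have hc' : 0 < (c + 1).re := by simp; linarith
  have hd' : 0 < (d + 1).re := by simp; linarith
  have hcd : 0 < (c + d + 2).re := by simp; linarith
  have hB : Complex.Gamma (c + 1) * Complex.Gamma (d + 1) / Complex.Gamma (c + d + 2) =
      Complex.betaIntegral (c + 1) (d + 1) := by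
    rw [Complex.Gamma_mul_Gamma_eq_betaIntegral hc' hd', show c + 1 + (d + 1) = c + d + 2 by ring,
      mul_div_cancel_left₀ _ (Complex.Gamma_ne_zero_of_re_pos hcd)]
  by_cases h : s < e
  · have key : ∫ x : ℝ, posPow c (x - s) * posPow d (e - x) =
        Complex.Gamma (c + 1) * Complex.Gamma (d + 1) / Complex.Gamma (c + d + 2) *
          posPow (c + d + 1) (e - s) := by
      have hr : 0 < e - s := sub_pos.2 h
      rw [hB, posPow, if_pos hr, mul_comm, show c + d + 1 = c + 1 + (d + 1) - 1 by ring,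
        ← Complex.betaIntegral_scaled _ _ hr, intervalIntegral.integral_of_le hr.le,
        integral_Ioc_eq_integral_Ioo, ← integral_indicator measurableSet_Ioo,
        ← integral_add_right_eq_self _ s]
      congr 1
      funext x
      rw [add_sub_cancel_right, ← sub_sub, sub_right_comm]
      by_cases h1 : 0 < x
      · by_cases h2 : 0 < e - s - x
        · rw [Set.indicator_of_mem (s := Set.Ioo 0 (e - s)) ⟨h1, by linarith⟩, posPow, posPow,
            if_pos h1, if_pos h2]
          simp
        · rw [Set.indicator_of_notMem (s := Set.Ioo 0 (e - s)) (fun h' => h2 (by linarith [h'.2])),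
            posPow, posPow, if_neg h2, mul_zero]
      · rw [Set.indicator_of_notMem (s := Set.Ioo 0 (e - s)) (fun h' => h1 h'.1), posPow,
          if_neg h1, zero_mul]
    refine ⟨?_, key⟩
    by_contra hn
    rw [integral_undef hn, posPow, if_pos (sub_pos.2 h)] at key
    refine absurd key.symm (mul_ne_zero (div_ne_zero (mul_ne_zero ?_ ?_) ?_) ?_)
    · exact Complex.Gamma_ne_zero_of_re_pos hc'
    · exact Complex.Gamma_ne_zero_of_re_pos hd'
    · exact Complex.Gamma_ne_zero_of_re_pos hcd
    · rw [Complex.cpow_def_of_ne_zero (by exact_mod_cast (sub_pos.2 h).ne')]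
      exact Complex.exp_ne_zero _
  · have h0 : (fun x : ℝ => posPow c (x - s) * posPow d (e - x)) = fun _ => 0 := by
      funext x
      by_cases h1 : 0 < x - s
      · rw [posPow, posPow, if_neg (by linarith : ¬ 0 < e - x), mul_zero]
      · rw [posPow, if_neg h1, zero_mul]
    rw [h0, posPow, if_neg (by linarith : ¬ 0 < e - s)]
    simp

theorem integral_posPow_sub_norm_sq {c : ℂ} (hc : -1 < c.re) (r : ℝ) :
    Integrable (fun z : ℂ => posPow c (r - ‖z‖ ^ 2)) ∧
    ∫ z : ℂ, posPow c (r - ‖z‖ ^ 2) = (Real.pi : ℂ) / (c + 1) * posPow (c + 1) r := by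
  have hc' : 0 < (c + 1).re := by simp; linarith
  have hc0 : c + 1 ≠ 0 := fun h => by simp [h] at hc'
  have key : ∫ z : ℂ, posPow c (r - ‖z‖ ^ 2) = (Real.pi : ℂ) / (c + 1) * posPow (c + 1) r := by
    have h1 := integral_fun_norm_addHaar (volume : Measure ℂ) (fun t => posPow c (r - t ^ 2))
    have h2 := integral_comp_rpow_Ioi_of_pos (g := fun t => posPow c (r - t)) (p := 2) two_pos
    have h3 := (integral_posPow_mul_posPow (c := 0) (d := c) (by simp) hc 0 r).2
    have h4 : ∫ x : ℝ, posPow 0 (x - 0) * posPow c (r - x) =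
        ∫ x in Set.Ioi (0 : ℝ), posPow c (r - x) := by
      rw [← integral_indicator measurableSet_Ioi]
      congr 1
      funext x
      by_cases hx : 0 < x
      · rw [Set.indicator_of_mem (Set.mem_Ioi.2 hx), posPow, if_pos (by simpa using hx)]
        simp
      · rw [Set.indicator_of_notMem (s := Set.Ioi 0) hx, posPow, if_neg (by simpa using hx), zero_mul]
    have h5 : ∫ x in Set.Ioi (0 : ℝ), ((2 : ℝ) * x ^ ((2 : ℝ) - 1)) • posPow c (r - x ^ (2 : ℝ)) =
        2 * ∫ x in Set.Ioi (0 : ℝ), x ^ (2 - 1) • posPow c (r - x ^ 2) := by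
      rw [← integral_const_mul]
      congr 1
      funext x
      norm_num
      ring
    rw [h1, Complex.finrank_real_complex, Measure.real, Complex.volume_ball]
    rw [← h4, h3, h5] at h2
    simp only [Complex.real_smul, nsmul_eq_mul] at h2 ⊢
    simp only [zero_add, sub_zero, Complex.Gamma_one, one_mul] at h2
    rw [show c + 2 = c + 1 + 1 by ring, Complex.Gamma_add_one _ hc0] at h2
    have hG := Complex.Gamma_ne_zero_of_re_pos hc'
    have h6 : Complex.Gamma (c + 1) / ((c + 1) * Complex.Gamma (c + 1)) = 1 / (c + 1) := by
      field_simp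
    rw [h6] at h2
    norm_num at h2 ⊢
    linear_combination (Real.pi : ℂ) * h2
  refine ⟨?_, key⟩
  by_cases hr : 0 < r
  · by_contra hn
    rw [integral_undef hn, posPow, if_pos hr] at key
    refine absurd key.symm (mul_ne_zero (div_ne_zero (by simp [Real.pi_ne_zero]) hc0) ?_)
    rw [Complex.cpow_def_of_ne_zero (by exact_mod_cast hr.ne')]
    exact Complex.exp_ne_zero _
  · have h0 : (fun z : ℂ => posPow c (r - ‖z‖ ^ 2)) = fun _ => 0 := by
      funext z
      rw [posPow, if_neg (by nlinarith [sq_nonneg ‖z‖])]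
    rw [h0]
    simp

theorem integral_posPow_sub_sum_norm_sq (n : ℕ) {c : ℂ} (hc : -1 < c.re) (r : ℝ) :
    Integrable (fun b : Fin n → ℂ => posPow c (r - ∑ i, ‖b i‖ ^ 2)) ∧
    ∫ b : Fin n → ℂ, posPow c (r - ∑ i, ‖b i‖ ^ 2) =
      (Real.pi : ℂ) ^ n * (Complex.Gamma (c + 1) / Complex.Gamma (c + 1 + n)) *
        posPow (c + n) r := by
  induction n generalizing c with
  | zero =>
    have hG := Complex.Gamma_ne_zero_of_re_pos (s := c + 1) (by simp; linarith)
    simp [integral_const, Measure.real, hG, volume_pi]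
  | succ n ih =>
    have hmp := (volume_preserving_piFinSuccAbove (fun _ : Fin (n + 1) => ℂ) 0).symm
    have hmeas : Measurable fun z : (Fin n → ℂ) × ℂ => posPow c (r - ∑ i, ‖z.1 i‖ ^ 2 - ‖z.2‖ ^ 2) :=
      (measurable_posPow c).comp (by fun_prop)
    have hcr : -1 < ((c.re : ℂ)).re := by simpa
    have hc1 : -1 < (c + 1).re := by simp; linarith
    have hcr1 : -1 < ((c.re : ℂ) + 1).re := by simp; linarith
    have hsec (b : Fin n → ℂ) := integral_posPow_sub_norm_sq hc (r - ∑ i, ‖b i‖ ^ 2)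
    have hprod := integrable_and_integral_prod (μ := (volume : Measure (Fin n → ℂ)))
      (ν := (volume : Measure ℂ)) hmeas
      (fun b => (hsec b).1) (fun b => (hsec b).2)
      (fun b => by
        simp only [norm_posPow]
        exact (integral_posPow_sub_norm_sq hcr (r - ∑ i, ‖b i‖ ^ 2)).2)
      ((ih hcr1).1.const_mul _)
    have hswap : MeasurePreserving (Prod.swap : (Fin n → ℂ) × ℂ → ℂ × (Fin n → ℂ)) :=
      Measure.measurePreserving_swap
    have hmp2 := hmp.comp hswap
    have hemb : MeasurableEmbedding ((MeasurableEquiv.piFinSuccAbove (fun _ : Fin (n + 1) => ℂ) 0).symm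
        ∘ (Prod.swap : (Fin n → ℂ) × ℂ → ℂ × (Fin n → ℂ))) :=
      (MeasurableEquiv.measurableEmbedding _).comp MeasurableEquiv.prodComm.measurableEmbedding
    have hfun : ∀ z : (Fin n → ℂ) × ℂ, posPow c (r - ∑ i, ‖z.1 i‖ ^ 2 - ‖z.2‖ ^ 2) =
        posPow c (r - ∑ i, ‖((MeasurableEquiv.piFinSuccAbove (fun _ : Fin (n + 1) => ℂ) 0).symm
        ∘ (Prod.swap : (Fin n → ℂ) × ℂ → ℂ × (Fin n → ℂ))) z i‖ ^ 2) := by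
      intro z
      congr 1
      rw [Fin.sum_univ_succ]
      simp [MeasurableEquiv.piFinSuccAbove]
      ring
    rw [← hmp2.integrable_comp_emb hemb, ← hmp2.integral_comp hemb]
    simp only [Function.comp_def] at hfun ⊢
    simp only [← hfun]
    refine ⟨hprod.1, ?_⟩
    rw [← Measure.volume_eq_prod] at hprod
    rw [hprod.2, integral_const_mul, (ih hc1).2]
    have hc0 : c + 1 ≠ 0 := fun h => by
      have := congrArg Complex.re h
      simp at this; linarith
    rw [Complex.Gamma_add_one _ hc0]
    push_cast
    rw [show c + 1 + 1 + (n : ℂ) = c + 1 + (n + 1) by ring, show c + 1 + (n : ℂ) = c + (n + 1) by ring]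
    field_simp
    ring

open scoped MatrixOrder in
theorem Matrix.PosSemidef.exists_eq_conjTranspose_mul_self {n : ℕ} {M : Matrix (Fin n) (Fin n) ℂ}
    (hM : M.PosSemidef) : ∃ A : Matrix (Fin n) (Fin n) ℂ, M = Aᴴ * A :=
  CStarAlgebra.nonneg_iff_eq_star_mul_self.mp hM.nonneg

/-- The quadratic form of a complex matrix, as a real number. -/
noncomputable def quadForm {n : ℕ} (M : Matrix (Fin n) (Fin n) ℂ) (b : Fin n → ℂ) : ℝ :=
  (star b ⬝ᵥ M *ᵥ b).re

theorem continuous_quadForm {n : ℕ} (M : Matrix (Fin n) (Fin n) ℂ) : Continuous (quadForm M) := by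
  unfold quadForm
  fun_prop

theorem quadForm_conjTranspose_mul_self {n : ℕ} (A : Matrix (Fin n) (Fin n) ℂ) (b : Fin n → ℂ) :
    quadForm (Aᴴ * A) b = ∑ i, ‖(A *ᵥ b) i‖ ^ 2 := by
  rw [quadForm, ← mulVec_mulVec, dotProduct_mulVec, ← star_mulVec, dotProduct, Complex.re_sum]
  refine Finset.sum_congr rfl fun i _ => ?_
  rw [Pi.star_apply, Complex.star_def, mul_comm, Complex.mul_conj, Complex.ofReal_re,
    Complex.normSq_eq_norm_sq]

theorem map_mulVec_volume {n : ℕ} (A : Matrix (Fin n) (Fin n) ℂ) (hA : A.det ≠ 0) :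
    Measure.map (fun b : Fin n → ℂ => A *ᵥ b) volume =
      ENNReal.ofReal (Complex.normSq A.det)⁻¹ • volume := by
  have hdet : LinearMap.det ((Matrix.toLin' A).restrictScalars ℝ) = Complex.normSq A.det := by
    rw [LinearMap.det_restrictScalars, LinearMap.det_toLin', Algebra.norm_complex_apply]
  have h := Measure.map_linearMap_addHaar_eq_smul_addHaar (volume : Measure (Fin n → ℂ))
    (f := (Matrix.toLin' A).restrictScalars ℝ) (by rw [hdet]; simpa using hA)
  rw [hdet, abs_of_nonneg (by simp [Complex.normSq_nonneg])] at h
  exact h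

theorem integral_posPow_sub_quadForm {n : ℕ} {M : Matrix (Fin n) (Fin n) ℂ} (hM : M.PosDef)
    {c : ℂ} (hc : -1 < c.re) (r : ℝ) :
    Integrable (fun b : Fin n → ℂ => posPow c (r - quadForm M b)) ∧
    ∫ b : Fin n → ℂ, posPow c (r - quadForm M b) =
      (M.det.re : ℂ)⁻¹ * ((Real.pi : ℂ) ^ n *
        (Complex.Gamma (c + 1) / Complex.Gamma (c + 1 + n)) * posPow (c + n) r) := by
  obtain ⟨A, rfl⟩ := hM.posSemidef.exists_eq_conjTranspose_mul_self
  have hdet : (Aᴴ * A).det = (Complex.normSq A.det : ℂ) := by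
    rw [det_mul, det_conjTranspose, Complex.star_def, mul_comm, Complex.mul_conj]
  have hA : A.det ≠ 0 := fun h => by
    have := hM.det_pos
    simp [hdet, h] at this
  have hmeas : Measurable fun b : Fin n → ℂ => posPow c (r - ∑ i, ‖b i‖ ^ 2) :=
    (measurable_posPow c).comp (by fun_prop)
  have hA' : Measurable fun b : Fin n → ℂ => A *ᵥ b := by fun_prop
  obtain ⟨hi, hv⟩ := integral_posPow_sub_sum_norm_sq n hc r
  have hi' : Integrable (fun b : Fin n → ℂ => posPow c (r - ∑ i, ‖b i‖ ^ 2))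
      (Measure.map (fun b : Fin n → ℂ => A *ᵥ b) volume) := by
    rw [map_mulVec_volume A hA]
    exact hi.smul_measure ENNReal.ofReal_ne_top
  simp only [quadForm_conjTranspose_mul_self]
  refine ⟨hi'.comp_measurable hA', ?_⟩
  rw [← integral_map (f := fun b : Fin n → ℂ => posPow c (r - ∑ i, ‖b i‖ ^ 2)) hA'.aemeasurable
    hmeas.aestronglyMeasurable, map_mulVec_volume A hA, integral_smul_measure, hv,
    ENNReal.toReal_ofReal (inv_nonneg.2 (Complex.normSq_nonneg _)), hdet, Complex.ofReal_re,
    Complex.real_smul, Complex.ofReal_inv]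

instance matrixComplexBorelSpace (m n : ℕ) : BorelSpace (Matrix (Fin m) (Fin n) ℂ) :=
  inferInstanceAs (BorelSpace (Fin m → Fin n → ℂ))

theorem measurableSet_posDef (n : ℕ) : MeasurableSet {X : Matrix (Fin n) (Fin n) ℂ | X.PosDef} := by
  have h : {X : Matrix (Fin n) (Fin n) ℂ | X.PosDef} =
      ({X | Xᴴ = X} ∩ ⋂ v : Fin n → ℂ, {X | 0 ≤ star v ⬝ᵥ X *ᵥ v}) ∩ {X | X.det ≠ 0} := by
    ext X
    simp only [Set.mem_inter_iff, Set.mem_iInter, Set.mem_ofPred_eq]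
    constructor
    · exact fun hX => ⟨⟨hX.1, fun v => hX.posSemidef.dotProduct_mulVec_nonneg v⟩, hX.det_pos.ne'⟩
    · rintro ⟨⟨h1, h2⟩, h3⟩
      rw [(PosSemidef.of_dotProduct_mulVec_nonneg h1 h2).posDef_iff_isUnit, isUnit_iff_isUnit_det]
      exact h3.isUnit
  rw [h]
  refine ((IsClosed.inter ?_ (isClosed_iInter fun v => ?_)).measurableSet).inter
    (IsOpen.measurableSet ?_)
  · exact isClosed_eq (by fun_prop) continuous_id
  · exact isClosed_le continuous_const (by fun_prop)
  · exact isOpen_ne_fun (by fun_prop) continuous_const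

open scoped Classical in
/-- The power `det(X) ^ c` on positive definite matrices, extended by zero. -/
noncomputable def detPow {n : ℕ} (c : ℂ) (X : Matrix (Fin n) (Fin n) ℂ) : ℂ :=
  if X.PosDef then (X.det.re : ℂ) ^ c else 0

theorem measurable_detPow {n : ℕ} (c : ℂ) :
    Measurable (detPow c : Matrix (Fin n) (Fin n) ℂ → ℂ) := by
  have : Measurable fun X : Matrix (Fin n) (Fin n) ℂ => X.det.re :=
    Continuous.measurable (by fun_prop)
  exact Measurable.ite (measurableSet_posDef n) (by fun_prop) measurable_const

theorem Matrix.PosDef.det_re_pos {n : ℕ} {X : Matrix (Fin n) (Fin n) ℂ} (hX : X.PosDef) :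
    0 < X.det.re :=
  (Complex.pos_iff.1 hX.det_pos).1

theorem Matrix.PosDef.ofReal_det_re {n : ℕ} {X : Matrix (Fin n) (Fin n) ℂ} (hX : X.PosDef) :
    (X.det.re : ℂ) = X.det :=
  Complex.ext rfl (Complex.pos_iff.1 hX.det_pos).2

theorem norm_detPow {n : ℕ} (c : ℂ) (X : Matrix (Fin n) (Fin n) ℂ) :
    ((‖detPow c X‖ : ℝ) : ℂ) = detPow c.re X := by
  unfold detPow
  split_ifs with h
  · rw [Complex.norm_cpow_eq_rpow_re_of_pos h.det_re_pos, Complex.ofReal_cpow h.det_re_pos.le]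
  · simp

/-- The matrix `[Y, b; bᴴ, x]` obtained by bordering `Y` with a last row and column. -/
def borderMatrix {n : ℕ} (Y : Matrix (Fin n) (Fin n) ℂ) (b : Fin n → ℂ) (x : ℝ) :
    Matrix (Fin (n + 1)) (Fin (n + 1)) ℂ :=
  (fromBlocks Y (replicateCol (Fin 1) b) (replicateCol (Fin 1) b)ᴴ
    (of fun _ _ => (x : ℂ))).submatrix finSumFinEquiv.symm finSumFinEquiv.symm

theorem one_sub_borderMatrix {n : ℕ} (Y : Matrix (Fin n) (Fin n) ℂ) (b : Fin n → ℂ) (x : ℝ) :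
    1 - borderMatrix Y b x = borderMatrix (1 - Y) (-b) (1 - x) := by
  ext i j
  obtain ⟨i, rfl⟩ := finSumFinEquiv.surjective i
  obtain ⟨j, rfl⟩ := finSumFinEquiv.surjective j
  rcases i with i | i <;> rcases j with j | j <;>
    simp [borderMatrix, one_apply, Fin.ext_iff] <;> omega

theorem posDef_of_posDef_borderMatrix {n : ℕ} {Y : Matrix (Fin n) (Fin n) ℂ} {b : Fin n → ℂ} {x : ℝ}
    (h : (borderMatrix Y b x).PosDef) : Y.PosDef := by
  have h1 := h.submatrix (e := Fin.castSucc) (Fin.castSucc_injective n)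
  convert h1
  ext i j
  have hi (i : Fin n) : finSumFinEquiv.symm i.castSucc = Sum.inl i :=
    finSumFinEquiv_symm_apply_castAdd i
  simp [borderMatrix, hi]

theorem det_borderMatrix {n : ℕ} {Y : Matrix (Fin n) (Fin n) ℂ} (hY : Y.PosDef) (b : Fin n → ℂ)
    (x : ℝ) : (borderMatrix Y b x).det = Y.det * ((x - quadForm Y⁻¹ b : ℝ) : ℂ) := by
  let := hY.isUnit.invertible
  have h := hY.inv.posSemidef.dotProduct_mulVec_nonneg b
  have h' : ((quadForm Y⁻¹ b : ℝ) : ℂ) = star b ⬝ᵥ Y⁻¹ *ᵥ b :=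
    Complex.ext rfl (Complex.nonneg_iff.1 h).2
  rw [borderMatrix, det_submatrix_equiv_self, det_fromBlocks₁₁, det_fin_one, Complex.ofReal_sub, h',
    dotProduct_mulVec]
  simp [mul_apply, dotProduct, vecMul]

theorem posDef_borderMatrix_iff {n : ℕ} {Y : Matrix (Fin n) (Fin n) ℂ} (hY : Y.PosDef)
    (b : Fin n → ℂ) (x : ℝ) : (borderMatrix Y b x).PosDef ↔ 0 < x - quadForm Y⁻¹ b := by
  let := hY.isUnit.invertible
  constructor
  · intro h
    have h1 := h.det_re_pos
    rw [det_borderMatrix hY, ← hY.ofReal_det_re, ← Complex.ofReal_mul, Complex.ofReal_re] at h1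
    exact (mul_pos_iff_of_pos_left hY.det_re_pos).1 h1
  · intro h
    have h2 : (borderMatrix Y b x).PosSemidef := by
      refine PosSemidef.submatrix ?_ _
      rw [PosDef.fromBlocks₁₁ _ _ hY]
      have h' : ((quadForm Y⁻¹ b : ℝ) : ℂ) = star b ⬝ᵥ Y⁻¹ *ᵥ b :=
        Complex.ext rfl
          (Complex.nonneg_iff.1 (hY.inv.posSemidef.dotProduct_mulVec_nonneg b)).2
      have h3 : (of fun _ _ => (x : ℂ)) - (replicateCol (Fin 1) b)ᴴ * Y⁻¹ * replicateCol (Fin 1) b =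
          diagonal fun _ : Fin 1 => ((x - quadForm Y⁻¹ b : ℝ) : ℂ) := by
        ext i j
        rw [Complex.ofReal_sub, h', dotProduct_mulVec, Subsingleton.elim i j, diagonal_apply_eq]
        simp [mul_apply, dotProduct, vecMul]
      rw [h3, posSemidef_diagonal_iff]
      exact fun _ => by exact_mod_cast h.le
    rw [h2.posDef_iff_isUnit, isUnit_iff_isUnit_det, det_borderMatrix hY]
    exact (mul_ne_zero hY.det_pos.ne' (by exact_mod_cast h.ne')).isUnit

theorem detPow_borderMatrix {n : ℕ} (c : ℂ) (Y : Matrix (Fin n) (Fin n) ℂ) (b : Fin n → ℂ)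
    (x : ℝ) : detPow c (borderMatrix Y b x) = detPow c Y * posPow c (x - quadForm Y⁻¹ b) := by
  by_cases hY : Y.PosDef
  · by_cases hx : 0 < x - quadForm Y⁻¹ b
    · rw [detPow, detPow, posPow, if_pos hY, if_pos hx, if_pos ((posDef_borderMatrix_iff hY b x).2 hx),
        det_borderMatrix hY, ← hY.ofReal_det_re, ← Complex.ofReal_mul, Complex.ofReal_re,
        Complex.ofReal_re, Complex.ofReal_mul,
        Complex.mul_cpow_ofReal_nonneg hY.det_re_pos.le hx.le]
    · rw [detPow, posPow, if_neg hx, if_neg (mt (posDef_borderMatrix_iff hY b x).1 hx), mul_zero]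
  · rw [detPow, detPow, if_neg hY, if_neg (mt posDef_of_posDef_borderMatrix hY), zero_mul]

theorem detPow_add_one {n : ℕ} {Y : Matrix (Fin n) (Fin n) ℂ} (hY : Y.PosDef) (c : ℂ) :
    detPow (c + 1) Y = detPow c Y * Y.det.re := by
  rw [detPow, detPow, if_pos hY, if_pos hY,
    Complex.cpow_add _ _ (by exact_mod_cast hY.det_re_pos.ne'), Complex.cpow_one]

theorem quadForm_neg {n : ℕ} (M : Matrix (Fin n) (Fin n) ℂ) (b : Fin n → ℂ) :
    quadForm M (-b) = quadForm M b := by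
  simp [quadForm, mulVec_neg]

theorem quadForm_add {n : ℕ} (M N : Matrix (Fin n) (Fin n) ℂ) (b : Fin n → ℂ) :
    quadForm (M + N) b = quadForm M b + quadForm N b := by
  simp [quadForm, add_mulVec]

theorem det_re_inv_add_inv_one_sub {n : ℕ} {Y : Matrix (Fin n) (Fin n) ℂ} (hY : Y.PosDef)
    (hY' : (1 - Y).PosDef) :
    ((Y⁻¹ + (1 - Y)⁻¹).det.re : ℂ)⁻¹ = Y.det.re * (1 - Y).det.re := by
  have h : Y⁻¹ + (1 - Y)⁻¹ = Y⁻¹ * (1 - Y)⁻¹ := by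
    have h1 : Y⁻¹ * Y = 1 := nonsing_inv_mul _ ((isUnit_iff_isUnit_det _).1 hY.isUnit)
    have h2 : (1 - Y) * (1 - Y)⁻¹ = 1 := mul_nonsing_inv _ ((isUnit_iff_isUnit_det _).1 hY'.isUnit)
    calc Y⁻¹ + (1 - Y)⁻¹ = Y⁻¹ * ((1 - Y) * (1 - Y)⁻¹) + (Y⁻¹ * Y) * (1 - Y)⁻¹ := by
          rw [h1, h2, mul_one, one_mul]
      _ = Y⁻¹ * (1 - Y)⁻¹ := by noncomm_ring
  rw [(hY.inv.add hY'.inv).ofReal_det_re, hY.ofReal_det_re, hY'.ofReal_det_re, h, det_mul,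
    det_nonsing_inv, det_nonsing_inv, Ring.inverse_eq_inv', mul_inv, inv_inv, inv_inv]

theorem measurable_toHermMatrix (n : ℕ) : Measurable (toHermMatrix n) := by
  refine measurable_pi_lambda _ fun i => measurable_pi_lambda _ fun j => ?_
  simp only [toHermMatrix, of_apply]
  split_ifs <;> fun_prop

instance sFinite_hermLebesgue (n : ℕ) : SFinite (hermLebesgue n) := by
  unfold hermLebesgue
  infer_instance

theorem continuous_borderMatrix (n : ℕ) :
    Continuous fun z : Matrix (Fin n) (Fin n) ℂ × ((Fin n → ℂ) × ℝ) =>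
      borderMatrix z.1 z.2.1 z.2.2 := by
  unfold borderMatrix
  refine Continuous.matrix_submatrix (Continuous.matrix_fromBlocks ?_ ?_ ?_ ?_) _ _
  · fun_prop
  · exact continuous_pi fun i => continuous_pi fun _ => by simp only [replicateCol_apply]; fun_prop
  · exact continuous_pi fun i => continuous_pi fun _ => by
      simp only [conjTranspose_apply, replicateCol_apply]; fun_prop
  · exact continuous_pi fun i => continuous_pi fun _ => by simp only [of_apply]; fun_prop

theorem measurable_borderMatrix (n : ℕ) :
    Measurable fun z : Matrix (Fin n) (Fin n) ℂ × ((Fin n → ℂ) × ℝ) =>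
      borderMatrix z.1 z.2.1 z.2.2 :=
  have : SecondCountableTopology (Matrix (Fin n) (Fin n) ℂ) :=
    inferInstanceAs (SecondCountableTopology (Fin n → Fin n → ℂ))
  (continuous_borderMatrix n).measurable

/-- The strictly upper triangular positions of a square matrix of size `n + 1` are those of its
leading block of size `n` and those of its last column. -/
noncomputable def upperSumEquiv (n : ℕ) :
    { q : Fin n × Fin n // q.1 < q.2 } ⊕ Fin n ≃ { q : Fin (n + 1) × Fin (n + 1) // q.1 < q.2 } :=
  Equiv.ofBijective
    (Sum.elim (fun q => ⟨(q.1.1.castSucc, q.1.2.castSucc), Fin.castSucc_lt_castSucc_iff.2 q.2⟩)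
      (fun i => ⟨(i.castSucc, Fin.last n), Fin.castSucc_lt_last i⟩)) <| by
    constructor
    · rintro (⟨⟨i, j⟩, h⟩ | i) (⟨⟨k, l⟩, h'⟩ | k) e <;>
        simp_all [Fin.ext_iff] <;> omega
    · rintro ⟨⟨i, j⟩, h⟩
      induction i using Fin.lastCases with
      | last => exact absurd h (Fin.le_last j).not_gt
      | cast i =>
        induction j using Fin.lastCases with
        | last => exact ⟨Sum.inr i, rfl⟩
        | cast j => exact ⟨Sum.inl ⟨(i, j), Fin.castSucc_lt_castSucc_iff.1 h⟩, rfl⟩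

theorem measurePreserving_comp_upperSumEquiv (n : ℕ) :
    MeasurePreserving (fun f : { q : Fin (n + 1) × Fin (n + 1) // q.1 < q.2 } → ℂ =>
      ((fun q => f (upperSumEquiv n (Sum.inl q)), fun i => f (upperSumEquiv n (Sum.inr i))) :
        ({ q : Fin n × Fin n // q.1 < q.2 } → ℂ) × (Fin n → ℂ))) := by
  have h1 := (volume_measurePreserving_piCongrLeft (fun _ => ℂ) (upperSumEquiv n)).symm
  have h2 := volume_measurePreserving_sumPiEquivProdPi
    (fun _ : { q : Fin n × Fin n // q.1 < q.2 } ⊕ Fin n => ℂ)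
  exact h2.comp h1

theorem measurePreserving_fin_init_last (n : ℕ) :
    MeasurePreserving (fun f : Fin (n + 1) → ℝ =>
      ((fun i => f i.castSucc, f (Fin.last n)) : (Fin n → ℝ) × ℝ)) := by
  have h1 := volume_preserving_piFinSuccAbove (fun _ : Fin (n + 1) => ℝ) (Fin.last n)
  have h2 : MeasurePreserving (Prod.swap : ℝ × (Fin n → ℝ) → (Fin n → ℝ) × ℝ) :=
    Measure.measurePreserving_swap
  convert h2.comp h1 using 1
  funext f
  ext i
  · simp [MeasurableEquiv.piFinSuccAbove, Fin.init]
  · simp [MeasurableEquiv.piFinSuccAbove]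

theorem measurePreserving_prod_regroup {A B C D : Type*} [MeasureSpace A] [MeasureSpace B]
    [MeasureSpace C] [MeasureSpace D] [SFinite (volume : Measure A)] [SFinite (volume : Measure B)]
    [SFinite (volume : Measure C)] [SFinite (volume : Measure D)] :
    MeasurePreserving (fun z : (A × B) × (C × D) => ((z.1.1, z.2.1), (z.2.2, z.1.2))) := by
  have h1 : MeasurePreserving (MeasurableEquiv.prodAssoc : (A × B) × (C × D) ≃ᵐ _) :=
    ⟨MeasurableEquiv.measurable _, Measure.prodAssoc_prod⟩
  have h2 : MeasurePreserving (Prod.swap : B × (C × D) → (C × D) × B) :=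
    Measure.measurePreserving_swap
  have h3 : MeasurePreserving (MeasurableEquiv.prodAssoc : (C × D) × B ≃ᵐ _) :=
    ⟨MeasurableEquiv.measurable _, Measure.prodAssoc_prod⟩
  have h4 : MeasurePreserving (MeasurableEquiv.prodAssoc : (A × C) × (D × B) ≃ᵐ _) :=
    ⟨MeasurableEquiv.measurable _, Measure.prodAssoc_prod⟩
  exact h4.symm.comp (((MeasurePreserving.id volume).prod (h3.comp h2)).comp h1)

theorem hermLebesgue_succ (n : ℕ) :
    hermLebesgue (n + 1) = Measure.map
      (fun z : Matrix (Fin n) (Fin n) ℂ × ((Fin n → ℂ) × ℝ) => borderMatrix z.1 z.2.1 z.2.2)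
      ((hermLebesgue n).prod volume) := by
  have hE := (measurePreserving_prod_regroup (A := Fin n → ℝ) (B := ℝ)
    (C := { q : Fin n × Fin n // q.1 < q.2 } → ℂ) (D := Fin n → ℂ)).comp
    ((measurePreserving_fin_init_last n).prod (measurePreserving_comp_upperSumEquiv n))
  have h1 : (hermLebesgue n).prod (volume : Measure ((Fin n → ℂ) × ℝ)) =
      Measure.map (Prod.map (toHermMatrix n) id)
        ((volume : Measure (HermParam n)).prod (volume : Measure ((Fin n → ℂ) × ℝ))) := by
    rw [← Measure.map_prod_map _ _ (measurable_toHermMatrix n) measurable_id, Measure.map_id]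
    rfl
  have hm : Measurable (Prod.map (toHermMatrix n) (id : (Fin n → ℂ) × ℝ → (Fin n → ℂ) × ℝ)) :=
    (measurable_toHermMatrix n).prodMap measurable_id
  rw [h1, ← Measure.volume_eq_prod]
  change _ = Measure.map _ (Measure.map _ (volume :
    Measure (((Fin n → ℝ) × ({ q : Fin n × Fin n // q.1 < q.2 } → ℂ)) × ((Fin n → ℂ) × ℝ))))
  rw [← hE.map_eq, Measure.map_map (measurable_borderMatrix n) hm,
    Measure.map_map ((measurable_borderMatrix n).comp hm) hE.measurable, hermLebesgue]
  congr 1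
  funext T
  have hi (i : Fin n) : finSumFinEquiv.symm i.castSucc = Sum.inl i :=
    finSumFinEquiv_symm_apply_castAdd i
  ext i j
  induction i using Fin.lastCases with
  | last =>
    induction j using Fin.lastCases with
    | last => simp [toHermMatrix, borderMatrix]
    | cast j =>
      simp [toHermMatrix, borderMatrix, hi, Fin.castSucc_lt_last, (Fin.castSucc_lt_last _).not_gt]
      rfl
  | cast i =>
    induction j using Fin.lastCases with
    | last =>
      simp [toHermMatrix, borderMatrix, hi, Fin.castSucc_lt_last]
      rfl
    | cast j =>
      simp [toHermMatrix, borderMatrix, hi]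
      rfl

theorem cGammaP_succ (n : ℕ) (a : ℂ) :
    cGammaP (n + 1) a = (Real.pi : ℂ) ^ n * Complex.Gamma (a - n) * cGammaP n a := by
  have h : (n + 1) * (n + 1 - 1) / 2 = n + n * (n - 1) / 2 := by
    rw [← Finset.sum_range_id_mul_two, ← Finset.sum_range_id_mul_two, Finset.sum_range_succ]
    omega
  rw [cGammaP, cGammaP, h, pow_add, Fin.prod_univ_castSucc]
  simp only [Fin.val_castSucc, Fin.val_last]
  ring

theorem integrable_and_integral_border {n : ℕ} {Y : Matrix (Fin n) (Fin n) ℂ} {c d : ℂ}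
    (hc : -1 < c.re) (hd : -1 < d.re) :
    Integrable (fun w : (Fin n → ℂ) × ℝ => detPow c (borderMatrix Y w.1 w.2) *
      detPow d (1 - borderMatrix Y w.1 w.2)) ∧
    ∫ w : (Fin n → ℂ) × ℝ, detPow c (borderMatrix Y w.1 w.2) *
        detPow d (1 - borderMatrix Y w.1 w.2) =
      (Real.pi : ℂ) ^ n * (Complex.Gamma (c + 1) * Complex.Gamma (d + 1) /
        Complex.Gamma (c + d + 2 + n)) * (detPow (c + 1) Y * detPow (d + 1) (1 - Y)) := by
  simp only [one_sub_borderMatrix, detPow_borderMatrix, quadForm_neg]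
  by_cases hY : Y.PosDef
  swap
  · simp [detPow, hY]
  by_cases hY' : (1 - Y).PosDef
  swap
  · simp [detPow, hY']
  have hM := hY.inv.add hY'.inv
  have hmeas : Measurable fun w : (Fin n → ℂ) × ℝ =>
      posPow c (w.2 - quadForm Y⁻¹ w.1) * posPow d (1 - quadForm (1 - Y)⁻¹ w.1 - w.2) := by
    have h1 := (continuous_quadForm Y⁻¹).measurable
    have h2 := (continuous_quadForm (1 - Y)⁻¹).measurable
    exact ((measurable_posPow c).comp (by fun_prop)).mul ((measurable_posPow d).comp (by fun_prop))
  have hsec {c d : ℂ} (hc : -1 < c.re) (hd : -1 < d.re) (b : Fin n → ℂ) :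
      Integrable (fun x : ℝ => posPow c (x - quadForm Y⁻¹ b) *
        posPow d (1 - quadForm (1 - Y)⁻¹ b - x)) ∧
      ∫ x : ℝ, posPow c (x - quadForm Y⁻¹ b) * posPow d (1 - quadForm (1 - Y)⁻¹ b - x) =
        Complex.Gamma (c + 1) * Complex.Gamma (d + 1) / Complex.Gamma (c + d + 2) *
          posPow (c + d + 1) (1 - quadForm (Y⁻¹ + (1 - Y)⁻¹) b) := by
    have h := integral_posPow_mul_posPow hc hd (quadForm Y⁻¹ b) (1 - quadForm (1 - Y)⁻¹ b)
    rwa [sub_sub, add_comm (quadForm _ b), ← quadForm_add] at h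
  have hcr : -1 < ((c.re : ℂ)).re := by simpa
  have hdr : -1 < ((d.re : ℂ)).re := by simpa
  have hcd : -1 < (c + d + 1).re := by simp; linarith
  have hcdr : -1 < ((c.re : ℂ) + d.re + 1).re := by simp; linarith
  obtain ⟨hi, hv⟩ := integrable_and_integral_prod (μ := (volume : Measure (Fin n → ℂ)))
    (ν := (volume : Measure ℝ)) hmeas (fun b => (hsec hc hd b).1) (fun b => (hsec hc hd b).2)
    (fun b => by
      simp only [norm_mul, Complex.ofReal_mul, norm_posPow]
      exact (hsec hcr hdr b).2)
    ((integral_posPow_sub_quadForm hM hcdr 1).1.const_mul _)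
  rw [← Measure.volume_eq_prod] at hi hv
  have hfun : (fun w : (Fin n → ℂ) × ℝ => detPow c Y * posPow c (w.2 - quadForm Y⁻¹ w.1) *
      (detPow d (1 - Y) * posPow d (1 - w.2 - quadForm (1 - Y)⁻¹ w.1))) =
      fun w => detPow c Y * detPow d (1 - Y) * (posPow c (w.2 - quadForm Y⁻¹ w.1) *
        posPow d (1 - quadForm (1 - Y)⁻¹ w.1 - w.2)) := by
    funext w
    rw [sub_right_comm]
    ring
  rw [hfun]
  refine ⟨hi.const_mul _, ?_⟩
  have hG : Complex.Gamma (c + d + 2) ≠ 0 :=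
    Complex.Gamma_ne_zero_of_re_pos (by simp; linarith)
  rw [integral_const_mul, hv, integral_const_mul, (integral_posPow_sub_quadForm hM hcd 1).2,
    det_re_inv_add_inv_one_sub hY hY', detPow_add_one hY, detPow_add_one hY',
    show c + d + 1 + 1 = c + d + 2 by ring, posPow, if_pos one_pos]
  simp only [Complex.ofReal_one, Complex.one_cpow]
  field_simp

theorem integral_detPow_mul_detPow (n : ℕ) {c d : ℂ} (hc : -1 < c.re) (hd : -1 < d.re) :
    Integrable (fun X => detPow c X * detPow d (1 - X)) (hermLebesgue n) ∧
    ∫ X, detPow c X * detPow d (1 - X) ∂(hermLebesgue n) =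
      cGammaP n (c + n) * cGammaP n (d + n) / cGammaP n (c + d + 2 * n) := by
  induction n generalizing c d with
  | zero =>
    have hf : (fun X : Matrix (Fin 0) (Fin 0) ℂ => detPow c X * detPow d (1 - X)) = fun _ => 1 := by
      funext X
      have h (Z : Matrix (Fin 0) (Fin 0) ℂ) : Z.PosDef := by
        rw [Subsingleton.elim Z 1]
        exact PosDef.one
      simp [detPow, h]
    have hu : hermLebesgue 0 Set.univ = 1 := by
      rw [hermLebesgue, Measure.map_apply (measurable_toHermMatrix 0) MeasurableSet.univ,
        Set.preimage_univ, Measure.volume_eq_prod, ← Set.univ_prod_univ,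
        Measure.prod_prod]
      simp [volume_pi]
    have : IsProbabilityMeasure (hermLebesgue 0) := ⟨hu⟩
    rw [hf]
    simp [cGammaP]
  | succ n ih =>
    have hcr : -1 < ((c.re : ℂ)).re := by simpa
    have hdr : -1 < ((d.re : ℂ)).re := by simpa
    have hc1 : -1 < (c + 1).re := by simp; linarith
    have hd1 : -1 < (d + 1).re := by simp; linarith
    have hcr1 : -1 < ((c.re : ℂ) + 1).re := by simp; linarith
    have hdr1 : -1 < ((d.re : ℂ) + 1).re := by simp; linarith
    have hF : Measurable fun X : Matrix (Fin (n + 1)) (Fin (n + 1)) ℂ =>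
        detPow c X * detPow d (1 - X) := by
      have h1 : Measurable fun X : Matrix (Fin (n + 1)) (Fin (n + 1)) ℂ => 1 - X :=
        Continuous.measurable (by fun_prop)
      exact (measurable_detPow c).mul ((measurable_detPow d).comp h1)
    have hB := measurable_borderMatrix n
    obtain ⟨hi, hv⟩ := integrable_and_integral_prod (μ := hermLebesgue n)
      (ν := (volume : Measure ((Fin n → ℂ) × ℝ))) (hF.comp hB)
      (fun Y => (integrable_and_integral_border (Y := Y) hc hd).1)
      (fun Y => (integrable_and_integral_border (Y := Y) hc hd).2)
      (fun Y => by
        simp only [Function.comp_def, norm_mul, Complex.ofReal_mul, norm_detPow]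
        exact (integrable_and_integral_border (Y := Y) hcr hdr).2)
      ((ih hcr1 hdr1).1.const_mul _)
    rw [hermLebesgue_succ]
    refine ⟨(integrable_map_measure hF.aestronglyMeasurable hB.aemeasurable).2 hi, ?_⟩
    rw [integral_map hB.aemeasurable hF.aestronglyMeasurable]
    refine hv.trans ?_
    rw [integral_const_mul, (ih hc1 hd1).2, cGammaP_succ, cGammaP_succ, cGammaP_succ]
    push_cast
    rw [show c + (n + 1 : ℂ) - n = c + 1 by ring, show d + (n + 1 : ℂ) - n = d + 1 by ring,
      show c + d + 2 * (n + 1 : ℂ) - n = c + d + 2 + n by ring,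
      show c + 1 + (n : ℂ) = c + (n + 1) by ring, show d + 1 + (n : ℂ) = d + (n + 1) by ring,
      show c + 1 + (d + 1) + 2 * (n : ℂ) = c + d + 2 * (n + 1) by ring]
    have hpi : (Real.pi : ℂ) ^ n ≠ 0 := pow_ne_zero _ (by exact_mod_cast Real.pi_ne_zero)
    field_simp

theorem stmt7 (p : ℕ) (hp : 1 ≤ p) (α β : ℂ)
    (hα : (p - 1 : ℝ) < α.re) (hβ : (p - 1 : ℝ) < β.re) :
    ∫ X in {X : Matrix (Fin p) (Fin p) ℂ | X.PosDef ∧ (1 - X).PosDef},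
      ((X.det.re : ℂ) ^ (α - p) * (((1 - X).det.re : ℂ) ^ (β - p))) ∂(hermLebesgue p)
    = cGammaP p α * cGammaP p β / cGammaP p (α + β) := by
  have h := (integral_detPow_mul_detPow p (c := α - p) (d := β - p) (by simp; linarith)
    (by simp; linarith)).2
  rw [sub_add_cancel, sub_add_cancel, show α - p + (β - p) + 2 * (p : ℂ) = α + β by ring] at h
  have h1 : Measurable fun X : Matrix (Fin p) (Fin p) ℂ => 1 - X :=
    Continuous.measurable (by fun_prop)
  have hs : MeasurableSet {X : Matrix (Fin p) (Fin p) ℂ | X.PosDef ∧ (1 - X).PosDef} :=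
    (measurableSet_posDef p).inter (h1 (measurableSet_posDef p))
  rw [← h, ← integral_indicator hs]
  congr 1
  funext X
  by_cases hX : X.PosDef <;> by_cases hX' : (1 - X).PosDef <;>
    simp [Set.indicator, detPow, hX, hX']
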